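/- Let r = (r_1,…,r_d) ∈ (0,∞)^d be a polyradius, let f be a holomorphic function on the polydisc D_r, let m ∈ ℕ and j ∈ {1,…,d}. Then the shift S_j(f) is a well-defined holomorphic function on D_r and ‖S_j(f)‖_m ≤ (4/r_j)·‖f‖_m, the inequality understood in [0,∞]. -/

import Mathlib

/- Infrastructure: polydiscs in ℂ^d, the modified distance-to-boundary
function d_r, and Nagumo norms (with values in [0,∞]). -/

open scoped BigOperators ENNReal
noncomputable section

/-- The open polydisc of polyradius `r` centered at the origin of ℂ^d. -/
def polydisc {d : ℕ} (r : Fin d → ℝ) : Set (Fin d → ℂ) := {x | ∀ i, ‖x i‖ < r i}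

/-- The modified boundary distance: d_r(x) = r − |x| if |x| ≥ r/2, and r/2 if |x| < r/2. -/
def dDist (r : ℝ) (x : ℂ) : ℝ := if ‖x‖ < r / 2 then r / 2 else r - ‖x‖

/-- The Nagumo norm of index `m` of a function on the polydisc of polyradius `r`:
‖f‖_m = sup_{x ∈ D_r} |f(x)| d_{r_1}(x_1)^m ⋯ d_{r_d}(x_d)^m ∈ [0,∞]. -/
def nagumo {d : ℕ} (r : Fin d → ℝ) (m : ℕ) (f : (Fin d → ℂ) → ℂ) : ℝ≥0∞ :=
  ⨆ x ∈ polydisc r, ENNReal.ofReal (‖f x‖ * ∏ i, dDist (r i) (x i) ^ m)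

open MeasureTheory Metric Filter Topology

/-- The integral over a compact interval of a jointly continuous family of holomorphic functions
of several variables is holomorphic. -/
theorem differentiableOn_intervalIntegral_of_continuousOn {ι : Type*} [Fintype ι]
    {F : ℝ → (ι → ℂ) → ℂ} {U : Set (ι → ℂ)} {a b : ℝ} (hab : a ≤ b) (hU : IsOpen U)
    (hF : ContinuousOn (Function.uncurry F) (Set.univ ×ˢ U))
    (hd : ∀ t, DifferentiableOn ℂ (F t) U) :
    DifferentiableOn ℂ (fun x => ∫ t in a..b, F t x) U := by
  classical
  intro x₀ hx₀
  obtain ⟨R, hR, hRU⟩ := nhds_basis_closedBall.mem_iff.1 (hU.mem_nhds hx₀)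
  have hbU : ball x₀ R ⊆ U := ball_subset_closedBall.trans hRU
  have hcont : ∀ x ∈ U, Continuous (fun t => F t x) := fun x hx =>
    continuousOn_univ.1 (hF.comp (f := fun t : ℝ => (t, x)) (by fun_prop) fun t _ => ⟨trivial, hx⟩)
  obtain ⟨M, hM⟩ := ((isCompact_Icc (a := a) (b := b)).prod
    (isCompact_closedBall x₀ R)).exists_bound_of_continuousOn
    (hF.mono (Set.prod_mono (Set.subset_univ _) hRU))
  have hderiv : ∀ t, HasFDerivAt (F t) (fderiv ℂ (F t) x₀) x₀ := fun t =>
    ((hd t).differentiableAt (hU.mem_nhds hx₀)).hasFDerivAt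
  have hmeas : AEStronglyMeasurable (fun t => fderiv ℂ (F t) x₀)
      (volume.restrict (Set.Ioc a b)) := by
    have hsum : (fun t => fderiv ℂ (F t) x₀) = fun t =>
        ∑ i, fderiv ℂ (F t) x₀ (Pi.single i 1) •
          (ContinuousLinearMap.proj i : (ι → ℂ) →L[ℂ] ℂ) := by
      funext t
      refine ContinuousLinearMap.ext fun v => ?_
      conv_lhs => rw [pi_eq_sum_univ' v, map_sum]
      simp [mul_comm]
    rw [hsum]
    refine Finset.aestronglyMeasurable_fun_sum _ fun i _ => AEStronglyMeasurable.smul_const ?_ _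
    obtain ⟨c, hc0, hc⟩ : ∃ c : ℕ → ℝ, (∀ n, 0 < c n ∧ c n < R) ∧ Tendsto c atTop (𝓝 0) := by
      obtain ⟨c, -, h, h'⟩ := exists_seq_strictAnti_tendsto' hR
      exact ⟨c, h, h'⟩
    refine aestronglyMeasurable_of_tendsto_ae atTop
      (f := fun n t => (c n : ℂ)⁻¹ • (F t (x₀ + (c n : ℂ) • Pi.single i 1) - F t x₀)) ?_ ?_
    · intro n
      have hmem : x₀ + (c n : ℂ) • Pi.single i (1 : ℂ) ∈ U := by
        apply hbU
        rw [mem_ball, dist_eq_norm, add_sub_cancel_left, norm_smul, Pi.norm_single]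
        simpa [abs_of_pos (hc0 n).1] using (hc0 n).2
      exact (((hcont _ hmem).fun_sub (hcont _ hx₀)).fun_const_smul _).aestronglyMeasurable
    · refine ae_of_all _ fun t => ?_
      have h := ((hderiv t).hasLineDerivAt (Pi.single i 1)).tendsto_slope_zero
      refine h.comp (tendsto_nhdsWithin_iff.2 ⟨?_, ?_⟩)
      · exact (Complex.continuous_ofReal.tendsto' 0 0 (by simp)).comp hc
      · exact Eventually.of_forall fun n => by simpa using (hc0 n).1.ne'
  have key := hasFDerivAt_integral_of_dominated_loc_of_lip' (𝕜 := ℂ)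
    (μ := volume.restrict (Set.Ioc a b)) (F := fun x t => F t x) (x₀ := x₀) (s := ball x₀ R)
    (F' := fun t => fderiv ℂ (F t) x₀) (bound := fun _ => (M + M) / R)
    (ball_mem_nhds x₀ hR)
    (fun x hx => (hcont x (hbU hx)).aestronglyMeasurable)
    ((hcont x₀ hx₀).integrableOn_Ioc)
    hmeas ?_ (integrable_const _) (ae_of_all _ hderiv)
  · simp only [intervalIntegral.integral_of_le hab]
    exact key.2.differentiableAt.differentiableWithinAt
  · refine ae_restrict_of_forall_mem measurableSet_Ioc fun t ht x hx => ?_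
    have hb : ∀ y ∈ closedBall x₀ R, ‖F t y‖ ≤ M := fun y hy =>
      hM (t, y) ⟨Set.Ioc_subset_Icc_self ht, hy⟩
    have := Complex.dist_le_div_mul_dist_of_mapsTo_ball (R₂ := M + M) ((hd t).mono hbU)
      (fun y hy => by
        rw [mem_closedBall, dist_eq_norm]
        exact (norm_sub_le _ _).trans (add_le_add (hb y (ball_subset_closedBall hy))
          (hb x₀ (mem_closedBall_self hR.le)))) hx
    simpa only [dist_eq_norm] using this

theorem isOpen_polydisc {d : ℕ} (r : Fin d → ℝ) : IsOpen (polydisc r) := by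
  simp only [polydisc, Set.ofPred_forall]
  exact isOpen_iInter_of_finite fun i => isOpen_lt (by fun_prop) continuous_const

theorem update_mem_polydisc {d : ℕ} {r : Fin d → ℝ} {x : Fin d → ℂ} (hx : x ∈ polydisc r)
    {j : Fin d} {w : ℂ} (hw : ‖w‖ < r j) : Function.update x j w ∈ polydisc r := by
  intro i
  rcases eq_or_ne i j with rfl | h
  · simpa using hw
  · simpa [h] using hx i

theorem DifferentiableOn.comp_update_polydisc {d : ℕ} {r : Fin d → ℝ} {f : (Fin d → ℂ) → ℂ}
    (hf : DifferentiableOn ℂ f (polydisc r)) {x : Fin d → ℂ} (hx : x ∈ polydisc r) (j : Fin d) :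
    DifferentiableOn ℂ (fun w => f (Function.update x j w)) (ball 0 (r j)) := by
  refine hf.comp (fun w _ => ((hasFDerivAt_update x w).differentiableAt).differentiableWithinAt) ?_
  intro w hw
  exact update_mem_polydisc hx (by simpa using hw)

/-- The shift operator `S_j`, as the slope at the origin in the `j`-th variable. -/
def shift {d : ℕ} (j : Fin d) (f : (Fin d → ℂ) → ℂ) (x : Fin d → ℂ) : ℂ :=
  dslope (fun w => f (Function.update x j w)) 0 (x j)

theorem eq_update_add_mul_shift {d : ℕ} (j : Fin d) (f : (Fin d → ℂ) → ℂ) (x : Fin d → ℂ) :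
    f x = f (Function.update x j 0) + x j * shift j f x := by
  have h := sub_smul_dslope (fun w => f (Function.update x j w)) 0 (x j)
  simp only [sub_zero, smul_eq_mul, Function.update_eq_self] at h
  rw [shift, h]
  ring

theorem differentiableOn_shift {d : ℕ} {r : Fin d → ℝ} {f : (Fin d → ℂ) → ℂ}
    (hf : DifferentiableOn ℂ f (polydisc r)) (j : Fin d) :
    DifferentiableOn ℂ (shift j f) (polydisc r) := by
  intro x₀ hx₀
  obtain ⟨ρ, hρ, hρr⟩ := exists_between (hx₀ j)
  have hρ0 : 0 < ρ := (norm_nonneg _).trans_lt hρ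
  have hrj : 0 < r j := hρ0.trans hρr
  set U : Set (Fin d → ℂ) := polydisc r ∩ {x | ‖x j‖ < ρ} with hUdef
  have hU : IsOpen U := (isOpen_polydisc r).inter (isOpen_lt (by fun_prop) continuous_const)
  set F : ℝ → (Fin d → ℂ) → ℂ := fun θ x => deriv (circleMap 0 ρ) θ *
    ((circleMap 0 ρ θ - x j)⁻¹ * ((circleMap 0 ρ θ)⁻¹ *
      (f (Function.update x j (circleMap 0 ρ θ)) - f (Function.update x j 0)))) with hFdef
  have hnorm : ∀ θ, ‖circleMap 0 ρ θ‖ = ρ := fun θ => by simp [abs_of_pos hρ0]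
  have hne : ∀ θ, circleMap 0 ρ θ ≠ 0 := fun θ => circleMap_ne_center hρ0.ne'
  have hne' : ∀ θ, ∀ x ∈ U, circleMap 0 ρ θ - x j ≠ 0 := fun θ x hx h => by
    have := hx.2
    rw [Set.mem_ofPred_eq, ← sub_eq_zero.1 h, hnorm] at this
    exact this.false
  have hupd : ∀ θ, ∀ x ∈ U, Function.update x j (circleMap 0 ρ θ) ∈ polydisc r :=
    fun θ x hx => update_mem_polydisc hx.1 (by rwa [hnorm])
  have hupd0 : ∀ x ∈ U, Function.update x j 0 ∈ polydisc r :=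
    fun x hx => update_mem_polydisc hx.1 (by simpa using hrj)
  have hFc : ContinuousOn (Function.uncurry F) (Set.univ ×ˢ U) := by
    have hcm : Continuous fun p : ℝ × (Fin d → ℂ) => circleMap 0 ρ p.1 := by fun_prop
    have h1 : ContinuousOn (fun p : ℝ × (Fin d → ℂ) =>
        f (Function.update p.2 j (circleMap 0 ρ p.1))) (Set.univ ×ˢ U) :=
      hf.continuousOn.comp (continuous_snd.update j hcm).continuousOn
        fun p hp => hupd p.1 p.2 hp.2
    have h2 : ContinuousOn (fun p : ℝ × (Fin d → ℂ) =>
        f (Function.update p.2 j 0)) (Set.univ ×ˢ U) :=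
      hf.continuousOn.comp (continuous_snd.update j continuous_const).continuousOn
        fun p hp => hupd0 p.2 hp.2
    have h3 : Continuous fun p : ℝ × (Fin d → ℂ) => deriv (circleMap 0 ρ) p.1 := by
      simp only [deriv_circleMap]
      fun_prop
    have h4 : Continuous fun p : ℝ × (Fin d → ℂ) => circleMap 0 ρ p.1 - p.2 j := by fun_prop
    exact h3.continuousOn.mul ((h4.continuousOn.inv₀ fun p hp => hne' p.1 p.2 hp.2).mul
      ((hcm.continuousOn.inv₀ fun p _ => hne p.1).mul (h1.sub h2)))
  have hupd_diff : ∀ w : ℂ, Differentiable ℂ fun x : Fin d → ℂ => Function.update x j w := by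
    intro w
    refine differentiable_pi.2 fun i => ?_
    rcases eq_or_ne i j with rfl | h
    · simp
    · simp only [Function.update_of_ne h]
      fun_prop
  have hFd : ∀ θ, DifferentiableOn ℂ (F θ) U := by
    intro θ
    have h1 : DifferentiableOn ℂ (fun x => f (Function.update x j (circleMap 0 ρ θ))) U :=
      hf.comp (hupd_diff _).differentiableOn fun x hx => hupd θ x hx
    have h2 : DifferentiableOn ℂ (fun x => f (Function.update x j 0)) U :=
      hf.comp (hupd_diff _).differentiableOn fun x hx => hupd0 x hx
    have h4 : DifferentiableOn ℂ (fun x : Fin d → ℂ => circleMap 0 ρ θ - x j) U := by fun_prop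
    exact ((h4.inv (hne' θ)).mul ((h1.sub h2).const_mul _)).const_mul _
  have hint := differentiableOn_intervalIntegral_of_continuousOn Real.two_pi_pos.le hU hFc hFd
  have heq : ∀ x ∈ U, shift j f x =
      (2 * Real.pi * Complex.I)⁻¹ * ∫ θ in (0)..(2 * Real.pi), F θ x := by
    intro x hx
    have hds : DifferentiableOn ℂ (dslope (fun w => f (Function.update x j w)) 0)
        (closedBall 0 ρ) :=
      ((Complex.differentiableOn_dslope (ball_mem_nhds 0 hrj)).2
        (hf.comp_update_polydisc hx.1 j)).mono (closedBall_subset_ball hρr)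
    have hC := hds.circleIntegral_sub_inv_smul (w := x j) (by simpa using hx.2)
    have hI : (∫ θ in (0)..(2 * Real.pi), F θ x) = ∮ z in C(0, ρ), (z - x j)⁻¹ •
        dslope (fun w => f (Function.update x j w)) 0 z := by
      rw [circleIntegral]
      refine intervalIntegral.integral_congr fun θ _ => ?_
      simp [hFdef, dslope_of_ne _ (hne θ), slope_def_field, div_eq_inv_mul]
    rw [hI, hC, shift, smul_eq_mul, inv_mul_cancel_left₀ Complex.two_pi_I_ne_zero]
  have hxU : U ∈ 𝓝 x₀ := hU.mem_nhds ⟨hx₀, hρ⟩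
  exact (((hint.const_mul _).congr heq).differentiableAt hxU).differentiableWithinAt

theorem eqOn_of_eq_update_add_mul {d : ℕ} {r : Fin d → ℝ} {f g g' : (Fin d → ℂ) → ℂ} {j : Fin d}
    (hg : ContinuousOn g (polydisc r)) (hg' : ContinuousOn g' (polydisc r))
    (h : ∀ x ∈ polydisc r, f x = f (Function.update x j 0) + x j * g x)
    (h' : ∀ x ∈ polydisc r, f x = f (Function.update x j 0) + x j * g' x) :
    Set.EqOn g' g (polydisc r) := by
  have hne : ∀ x ∈ polydisc r, x j ≠ 0 → g' x = g x := fun x hx h0 =>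
    mul_left_cancel₀ h0 (add_left_cancel ((h' x hx).symm.trans (h x hx)))
  intro x hx
  have hopen := (isOpen_polydisc r).mem_nhds hx
  have hcu : Tendsto (fun w : ℂ => Function.update x j w) (𝓝[≠] (x j)) (𝓝 x) :=
    ((continuous_const.update j continuous_id).tendsto' (x j) x (by simp)).mono_left
      nhdsWithin_le_nhds
  refine tendsto_nhds_unique (((hg'.continuousAt hopen).tendsto.comp hcu).congr' ?_)
    ((hg.continuousAt hopen).tendsto.comp hcu)
  rcases eq_or_ne (x j) 0 with h0 | h0
  · filter_upwards [hcu hopen, self_mem_nhdsWithin] with w hw hw0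
    exact hne _ hw (by simpa [h0] using hw0)
  · filter_upwards [hcu hopen, nhdsWithin_le_nhds (isOpen_ne.mem_nhds h0)] with w hw hw0
    exact hne _ hw (by simpa using hw0)

theorem dDist_nonneg {r : ℝ} {x : ℂ} (hx : ‖x‖ ≤ r) : 0 ≤ dDist r x := by
  have := norm_nonneg x
  unfold dDist
  split_ifs <;> linarith

theorem dDist_le_half (r : ℝ) (x : ℂ) : dDist r x ≤ r / 2 := by
  unfold dDist
  split_ifs <;> linarith

theorem dDist_of_norm_le_half {r : ℝ} {x : ℂ} (hx : ‖x‖ ≤ r / 2) : dDist r x = r / 2 := by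
  unfold dDist
  split_ifs <;> linarith

theorem prod_dDist_pow_le_prod_update {d : ℕ} {r : Fin d → ℝ} {x : Fin d → ℂ}
    (hx : x ∈ polydisc r) (m : ℕ) {j : Fin d} {w : ℂ} (hw : ‖w‖ ≤ r j / 2) :
    ∏ i, dDist (r i) (x i) ^ m ≤ ∏ i, dDist (r i) (Function.update x j w i) ^ m := by
  refine Finset.prod_le_prod (fun i _ => pow_nonneg (dDist_nonneg (hx i).le) _) fun i _ =>
    pow_le_pow_left₀ (dDist_nonneg (hx i).le) ?_ _
  rcases eq_or_ne i j with rfl | h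
  · simpa [dDist_of_norm_le_half hw] using dDist_le_half _ _
  · simp [h]

theorem ofReal_norm_mul_le_nagumo {d : ℕ} {r : Fin d → ℝ} (m : ℕ) (f : (Fin d → ℂ) → ℂ)
    {x : Fin d → ℂ} (hx : x ∈ polydisc r) :
    ENNReal.ofReal (‖f x‖ * ∏ i, dDist (r i) (x i) ^ m) ≤ nagumo r m f :=
  le_iSup₂ (f := fun x (_ : x ∈ polydisc r) =>
    ENNReal.ofReal (‖f x‖ * ∏ i, dDist (r i) (x i) ^ m)) x hx

theorem ofReal_norm_mul_le_of_half_le {d : ℕ} {r : Fin d → ℝ} {f g : (Fin d → ℂ) → ℂ} {j : Fin d}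
    (hr : 0 < r j) (m : ℕ) {x : Fin d → ℂ} (hx : x ∈ polydisc r) (hxj : r j / 2 ≤ ‖x j‖)
    (h : f x = f (Function.update x j 0) + x j * g x) :
    ENNReal.ofReal (‖g x‖ * ∏ i, dDist (r i) (x i) ^ m) ≤
      ENNReal.ofReal (4 / r j) * nagumo r m f := by
  have hx0 : Function.update x j 0 ∈ polydisc r := update_mem_polydisc hx (by simpa using hr)
  have hW : 0 ≤ ∏ i, dDist (r i) (x i) ^ m :=
    Finset.prod_nonneg fun i _ => pow_nonneg (dDist_nonneg (hx i).le) _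
  have hWle := prod_dDist_pow_le_prod_update hx m (j := j) (w := 0) (by simpa using (half_pos hr).le)
  set W := ∏ i, dDist (r i) (x i) ^ m
  set W₀ := ∏ i, dDist (r i) (Function.update x j 0 i) ^ m
  have hgx : r j / 2 * ‖g x‖ ≤ ‖f x‖ + ‖f (Function.update x j 0)‖ := by
    calc r j / 2 * ‖g x‖ ≤ ‖x j‖ * ‖g x‖ := by gcongr
      _ = ‖f x - f (Function.update x j 0)‖ := by rw [← norm_mul, h]; congr 1; ring
      _ ≤ _ := norm_sub_le _ _
  have hreal : ‖g x‖ * W ≤ 2 / r j * (‖f x‖ * W + ‖f (Function.update x j 0)‖ * W₀) := by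
    calc ‖g x‖ * W = 2 / r j * ((r j / 2 * ‖g x‖) * W) := by field_simp
      _ ≤ 2 / r j * ((‖f x‖ + ‖f (Function.update x j 0)‖) * W) := by gcongr
      _ ≤ _ := by rw [add_mul]; gcongr
  calc ENNReal.ofReal (‖g x‖ * W)
      ≤ ENNReal.ofReal (2 / r j * (‖f x‖ * W + ‖f (Function.update x j 0)‖ * W₀)) :=
        ENNReal.ofReal_le_ofReal hreal
    _ = ENNReal.ofReal (2 / r j) * (ENNReal.ofReal (‖f x‖ * W) +
          ENNReal.ofReal (‖f (Function.update x j 0)‖ * W₀)) := by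
        have hW₀ := hW.trans hWle
        rw [ENNReal.ofReal_mul (by positivity), ENNReal.ofReal_add (by positivity) (by positivity)]
    _ ≤ ENNReal.ofReal (2 / r j) * (nagumo r m f + nagumo r m f) := by
        gcongr
        · exact ofReal_norm_mul_le_nagumo m f hx
        · exact ofReal_norm_mul_le_nagumo m f hx0
    _ = ENNReal.ofReal (4 / r j) * nagumo r m f := by
        rw [← two_mul, ← mul_assoc, ← ENNReal.ofReal_ofNat 2, ← ENNReal.ofReal_mul (by positivity)]
        congr 2
        ring

theorem nagumo_le_of_eq_update_add_mul {d : ℕ} {r : Fin d → ℝ} {f g : (Fin d → ℂ) → ℂ} {j : Fin d}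
    (hr : 0 < r j) (m : ℕ) (hg : DifferentiableOn ℂ g (polydisc r))
    (h : ∀ x ∈ polydisc r, f x = f (Function.update x j 0) + x j * g x) :
    nagumo r m g ≤ ENNReal.ofReal (4 / r j) * nagumo r m f := by
  refine iSup₂_le fun x hx => ?_
  rcases le_or_gt (r j / 2) ‖x j‖ with hxj | hxj
  · exact ofReal_norm_mul_le_of_half_le hr m hx hxj (h x hx)
  have hr2 : r j / 2 ≠ 0 := by positivity
  have hdiff : DiffContOnCl ℂ (fun w => g (Function.update x j w)) (ball 0 (r j / 2)) := by
    refine ((hg.comp_update_polydisc hx j).mono ?_).diffContOnCl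
    rw [closure_ball _ hr2]
    exact closedBall_subset_ball (by linarith)
  obtain ⟨z, hz, hmax⟩ := Complex.exists_mem_frontier_isMaxOn_norm isBounded_ball
    ⟨0, mem_ball_self (by positivity)⟩ hdiff
  rw [frontier_ball _ hr2, mem_sphere_zero_iff_norm] at hz
  have hle : ‖g x‖ ≤ ‖g (Function.update x j z)‖ := by
    simpa using hmax (subset_closure (show x j ∈ ball 0 (r j / 2) by simpa using hxj))
  have hzx : Function.update x j z ∈ polydisc r := update_mem_polydisc hx (by linarith)
  refine le_trans (ENNReal.ofReal_le_ofReal ?_)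
    (ofReal_norm_mul_le_of_half_le hr m hzx (by simp [hz]) (h _ hzx))
  exact mul_le_mul hle (prod_dDist_pow_le_prod_update hx m hz.le)
    (Finset.prod_nonneg fun i _ => pow_nonneg (dDist_nonneg (hx i).le) _) (norm_nonneg _)

/-- Proposition on Nagumo norms, part (3).
For f holomorphic on the polydisc D_r, the shift S_j(f) — the unique
holomorphic function g on D_r with f(x) = f(x_1,…,0,…,x_d) + x_j·g(x) on D_r —
is well defined (it exists, and is unique as a function on D_r), and every
such g satisfies ‖S_j(f)‖_m ≤ (4/r_j)·‖f‖_m in [0,∞]. -/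
theorem stmt6 {d : ℕ} (hd : 1 ≤ d) (r : Fin d → ℝ) (hr : ∀ i, 0 < r i)
    (f : (Fin d → ℂ) → ℂ) (hf : DifferentiableOn ℂ f (polydisc r))
    (m : ℕ) (j : Fin d) :
    (∃ g : (Fin d → ℂ) → ℂ, DifferentiableOn ℂ g (polydisc r) ∧
      (∀ x ∈ polydisc r, f x = f (Function.update x j 0) + x j * g x) ∧
      ∀ g' : (Fin d → ℂ) → ℂ,
        (DifferentiableOn ℂ g' (polydisc r) ∧
          ∀ x ∈ polydisc r, f x = f (Function.update x j 0) + x j * g' x) →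
        Set.EqOn g' g (polydisc r)) ∧
    (∀ g : (Fin d → ℂ) → ℂ,
      (DifferentiableOn ℂ g (polydisc r) ∧
        ∀ x ∈ polydisc r, f x = f (Function.update x j 0) + x j * g x) →
      nagumo r m g ≤ ENNReal.ofReal (4 / r j) * nagumo r m f) := by
  refine ⟨⟨shift j f, differentiableOn_shift hf j, fun x _ => eq_update_add_mul_shift j f x, ?_⟩, ?_⟩
  · rintro g ⟨hg, hgf⟩
    exact eqOn_of_eq_update_add_mul (differentiableOn_shift hf j).continuousOn hg.continuousOn
      (fun x _ => eq_update_add_mul_shift j f x) hgf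
  · rintro g ⟨hg, hgf⟩
    exact nagumo_le_of_eq_update_add_mul (hr j) m hg hgf
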